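/- Let -3 ≤ γ ≤ 1, let k ≥ 7 be real, and let β ∈ ℕ³ be a multi-index with |β| ≤ 2. Then there exists a constant C_k > 0 such that for all Schwartz functions f, g : ℝ³ → ℝ, ∫_{ℝ³} Q(f, ∂_β μ)(v) · g(v) · ⟨v⟩^{2k} dv ≤ C_k · ‖⟨v⟩⁵ f‖_{L²(ℝ³)} · ‖⟨v⟩⁵ g‖_{L²(ℝ³)}, where ∂_β μ denotes the corresponding iterated partial derivative of the Maxwellian μ. -/

import Mathlib

open Real MeasureTheory

noncomputable abbrev jap (v : EuclideanSpace ℝ (Fin 3)) : ℝ := Real.sqrt (2 + ‖v‖ ^ 2)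

/-- The standard Maxwellian `μ(v) = (2π)^{-3/2} e^{-|v|²/2}` on `ℝ³`. -/
noncomputable def Mu (v : EuclideanSpace ℝ (Fin 3)) : ℝ :=
  (2 * Real.pi) ^ (-(3 : ℝ) / 2) * Real.exp (-‖v‖ ^ 2 / 2)

/-- The standard coordinate vector `e_i` in `ℝ³`. -/
noncomputable def e3 (i : Fin 3) : EuclideanSpace ℝ (Fin 3) := EuclideanSpace.single i 1

/-- The Landau projection matrix entries `a_{ij}(u) = |u|^{γ+2}(δ_{ij} - u_i u_j/|u|²)`. -/
noncomputable def Aent (γ : ℝ) (i j : Fin 3) (u : EuclideanSpace ℝ (Fin 3)) : ℝ :=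
  ‖u‖ ^ (γ + 2) * ((if i = j then (1 : ℝ) else 0) - u i * u j / ‖u‖ ^ 2)

/-- The Landau collision operator
`Q(g,f)(v) = ∇_v · ∫ Φ(v-v_*)(g(v_*) ∇_v f(v) - f(v) ∇_{v_*} g(v_*)) dv_*`. -/
noncomputable def LandauQ (γ : ℝ) (g f : EuclideanSpace ℝ (Fin 3) → ℝ)
    (v : EuclideanSpace ℝ (Fin 3)) : ℝ :=
  ∑ i : Fin 3, fderiv ℝ (fun u => ∫ w, ∑ j : Fin 3,
    Aent γ i j (u - w) * (g w * fderiv ℝ f u (e3 j) - f u * fderiv ℝ g w (e3 j))) v (e3 i)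

/-- Partial derivative in the `i`-th velocity direction. -/
noncomputable def pd (i : Fin 3) (f : EuclideanSpace ℝ (Fin 3) → ℝ) :
    EuclideanSpace ℝ (Fin 3) → ℝ :=
  fun v => fderiv ℝ f v (e3 i)

/-- The iterated partial derivative `∂_β` for a multi-index `β ∈ ℕ³`. -/
noncomputable def mderiv (β : Fin 3 → ℕ) (f : EuclideanSpace ℝ (Fin 3) → ℝ) :
    EuclideanSpace ℝ (Fin 3) → ℝ :=
  (pd 0)^[β 0] ((pd 1)^[β 1] ((pd 2)^[β 2] f))

/-- Weighted `L²` norm `‖⟨v⟩^ℓ f‖_{L²}`. -/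
noncomputable def wL2 (ℓ : ℝ) (f : EuclideanSpace ℝ (Fin 3) → ℝ) : ℝ :=
  Real.sqrt (∫ v, jap v ^ (2 * ℓ) * f v ^ 2)

abbrev V3 : Type := EuclideanSpace ℝ (Fin 3)

lemma jap_sq (v : V3) : jap v ^ 2 = 2 + ‖v‖ ^ 2 := Real.sq_sqrt (by positivity)

lemma jap_pos (v : V3) : 0 < jap v := Real.sqrt_pos.2 (by positivity)

lemma one_le_jap (v : V3) : 1 ≤ jap v := by
  rw [← abs_of_pos (jap_pos v), ← one_le_sq_iff_one_le_abs, jap_sq]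
  nlinarith [sq_nonneg ‖v‖]

lemma continuous_jap : Continuous (fun v : V3 => jap v) := by
  unfold jap; fun_prop

lemma jap_le_mul_jap_sub (u w : V3) : jap w ≤ jap u * jap (u - w) := by
  rw [← abs_of_pos (jap_pos w), ← abs_of_pos (mul_pos (jap_pos u) (jap_pos (u - w)))]
  apply sq_le_sq.1
  rw [mul_pow, jap_sq, jap_sq, jap_sq]
  have h : ‖w‖ ≤ ‖u‖ + ‖u - w‖ := by
    simpa using norm_sub_le u (u - w)
  nlinarith [sq_nonneg (‖u‖ - ‖u - w‖), norm_nonneg w, norm_nonneg u, norm_nonneg (u - w),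
    mul_nonneg (sq_nonneg ‖u‖) (sq_nonneg ‖u - w‖)]

lemma jap_sq_le (v : V3) : jap v ^ 2 ≤ 2 * (1 + ‖v‖) ^ 2 := by
  rw [jap_sq]; nlinarith [norm_nonneg v]

lemma norm_le_jap (v : V3) : ‖v‖ ≤ jap v := by
  rw [← abs_of_pos (jap_pos v), ← abs_of_nonneg (norm_nonneg v)]
  apply sq_le_sq.1
  rw [jap_sq]; linarith

lemma integrable_jap_rpow {r : ℝ} (hr : 3 < r) : Integrable (fun v : V3 => jap v ^ (-r)) := by
  have h := integrable_rpow_neg_one_add_norm_sq (E := V3) (μ := volume) (r := r) (by simpa using hr)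
  refine h.mono' (Continuous.aestronglyMeasurable ?_) (Filter.Eventually.of_forall fun v => ?_)
  · exact continuous_jap.rpow_const fun v => Or.inl (jap_pos v).ne'
  · rw [Real.norm_of_nonneg (Real.rpow_nonneg (jap_pos v).le _), jap, Real.sqrt_eq_rpow,
      ← Real.rpow_mul (by positivity), show (1 / 2 : ℝ) * -r = -r / 2 by ring]
    exact Real.rpow_le_rpow_of_nonpos (by positivity) (by linarith) (by linarith)

lemma integrable_jap_inv_pow {n : ℕ} (hn : 3 < n) : Integrable (fun v : V3 => (jap v ^ n)⁻¹) := by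
  refine (integrable_jap_rpow (r := n) (by exact_mod_cast hn)).congr
    (Filter.Eventually.of_forall fun v => ?_)
  simp [Real.rpow_neg (jap_pos v).le]

/-- The part of `|u|^s` supported in the unit ball. -/
noncomputable def nearKer (s : ℝ) : V3 → ℝ :=
  (Metric.ball (0 : V3) 1).indicator fun u => ‖u‖ ^ s

lemma nearKer_nonneg (s : ℝ) (u : V3) : 0 ≤ nearKer s u :=
  Set.indicator_nonneg (fun _ _ => Real.rpow_nonneg (norm_nonneg _) _) _

lemma measurable_nearKer (s : ℝ) : Measurable (nearKer s) :=
  (by fun_prop : Measurable fun u : V3 => ‖u‖ ^ s).indicator measurableSet_ball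

lemma integrable_nearKer {s : ℝ} (hs : -3 < s) : Integrable (nearKer s) := by
  rw [nearKer, integrable_indicator_iff measurableSet_ball]
  rw [integrableOn_fun_norm_addHaar (μ := (volume : Measure V3)) (f := fun y => y ^ s) (r := 1)]
  have h := (intervalIntegral.integrableOn_Ioo_rpow_iff (s := 2 + s) (t := 1) one_pos).2
    (by linarith)
  refine h.congr_fun (fun y hy => ?_) measurableSet_Ioo
  simp only [finrank_euclideanSpace, Fintype.card_fin, smul_eq_mul]
  rw [Real.rpow_add hy.1]
  norm_num

lemma norm_rpow_le_nearKer_add {s : ℝ} (hs : s ≤ 3) (u : V3) :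
    ‖u‖ ^ s ≤ nearKer s u + jap u ^ 3 := by
  by_cases hu : ‖u‖ < 1
  · rw [nearKer, Set.indicator_of_mem (by simpa using hu)]
    have := pow_pos (jap_pos u) 3
    linarith
  · have h1 : ‖u‖ ^ s ≤ ‖u‖ ^ (3 : ℝ) := Real.rpow_le_rpow_of_exponent_le (not_lt.1 hu) hs
    have h2 : ‖u‖ ^ 3 ≤ jap u ^ 3 := pow_le_pow_left₀ (norm_nonneg u) (norm_le_jap u) 3
    have h3 := nearKer_nonneg s u
    norm_num at h1
    linarith

open scoped SchwartzMap LineDeriv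

/-- Kernels dominated by an integrable function plus a power of the Japanese bracket. -/
structure IsKer (A κ : V3 → ℝ) : Prop where
  meas : Measurable A
  meas_ker : Measurable κ
  nonneg : ∀ u, 0 ≤ κ u
  int : Integrable κ
  bound : ∀ u, |A u| ≤ 2 * (κ u + jap u ^ 3)

lemma exists_jap_bound {F : Type*} [NormedAddCommGroup F] [NormedSpace ℝ F] (h : 𝓢(V3, F)) :
    ∃ C, 0 ≤ C ∧ ∀ x, ‖h x‖ ≤ C * (jap x ^ 8)⁻¹ := by
  obtain ⟨C, hC⟩ : ∃ C, ∀ x, (1 + ‖x‖) ^ 8 * ‖h x‖ ≤ C :=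
    ⟨_, fun x => by
      simpa using SchwartzMap.one_add_le_sup_seminorm_apply (𝕜 := ℝ) (m := (8, 0)) (k := 8) (n := 0)
        le_rfl le_rfl h x⟩
  have hC0 : 0 ≤ C := le_trans (by positivity) (hC 0)
  refine ⟨16 * C, by positivity, fun x => ?_⟩
  have hj := pow_pos (jap_pos x) 8
  rw [← div_eq_mul_inv, le_div_iff₀ hj]
  have h1 : jap x ^ 8 ≤ 16 * (1 + ‖x‖) ^ 8 := by
    calc jap x ^ 8 = (jap x ^ 2) ^ 4 := by ring
      _ ≤ (2 * (1 + ‖x‖) ^ 2) ^ 4 := pow_le_pow_left₀ (by positivity) (jap_sq_le x) 4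
      _ = _ := by ring
  calc ‖h x‖ * jap x ^ 8 ≤ ‖h x‖ * (16 * (1 + ‖x‖) ^ 8) := by gcongr
    _ ≤ _ := by nlinarith [hC x]

lemma exists_jap_bound_sub {F : Type*} [NormedAddCommGroup F] [NormedSpace ℝ F] (h : 𝓢(V3, F)) :
    ∃ C, 0 ≤ C ∧ ∀ u w, ‖h (u - w)‖ ≤ C * jap u ^ 8 * (jap w ^ 8)⁻¹ := by
  obtain ⟨C, hC0, hC⟩ := exists_jap_bound h
  refine ⟨C, hC0, fun u w => (hC _).trans ?_⟩
  have h1 : jap w ^ 8 ≤ jap u ^ 8 * jap (u - w) ^ 8 := by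
    rw [← mul_pow]; exact pow_le_pow_left₀ (jap_pos w).le (jap_le_mul_jap_sub u w) 8
  have hw := pow_pos (jap_pos w) 8
  have hu := pow_pos (jap_pos (u - w)) 8
  rw [mul_assoc]
  gcongr
  rw [← div_eq_mul_inv, inv_eq_one_div, div_le_div_iff₀ hu hw]
  linarith

lemma IsKer.integrable_dom {A κ : V3 → ℝ} (hA : IsKer A κ) :
    Integrable fun w => (κ w + jap w ^ 3) * (jap w ^ 8)⁻¹ := by
  have h := hA.int.add (integrable_jap_inv_pow (n := 5) (by norm_num))
  have hm := hA.meas_ker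
  have hj := continuous_jap.measurable
  refine h.mono' (by measurability) (Filter.Eventually.of_forall fun w => ?_)
  have hw := jap_pos w
  have h0 := hA.nonneg w
  rw [Real.norm_of_nonneg (by positivity), add_mul]
  have h1 : jap w ^ 3 * (jap w ^ 8)⁻¹ = (jap w ^ 5)⁻¹ := by field_simp
  have h2 : (jap w ^ 8)⁻¹ ≤ 1 := inv_le_one_of_one_le₀ (one_le_pow₀ (one_le_jap w))
  simp only [Pi.add_apply]
  rw [h1]
  nlinarith

lemma IsKer.integrable_smul {F : Type*} [NormedAddCommGroup F] [NormedSpace ℝ F]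
    {A κ : V3 → ℝ} (hA : IsKer A κ) (h : 𝓢(V3, F)) (u : V3) :
    Integrable fun w => A w • h (u - w) := by
  obtain ⟨C, hC0, hC⟩ := exists_jap_bound_sub h
  refine (hA.integrable_dom.const_mul (2 * (C * jap u ^ 8))).mono'
    (hA.meas.aestronglyMeasurable.smul
      (h.continuous.comp (continuous_const.sub continuous_id)).aestronglyMeasurable)
    (Filter.Eventually.of_forall fun w => ?_)
  rw [norm_smul, Real.norm_eq_abs]
  have h0 := hA.nonneg w
  have hw := jap_pos w
  calc |A w| * ‖h (u - w)‖ ≤ (2 * (κ w + jap w ^ 3)) * (C * jap u ^ 8 * (jap w ^ 8)⁻¹) := by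
        gcongr
        · exact hA.bound w
        · exact hC u w
    _ = _ := by ring

lemma IsKer.integrable_dom_mul {A κ : V3 → ℝ} (hA : IsKer A κ) (h : 𝓢(V3, ℝ)) (u : V3) :
    Integrable fun w => (κ w + jap w ^ 3) * |h (u - w)| := by
  have hm := hA.meas_ker
  have hj := continuous_jap.measurable
  have hK : IsKer (fun w => κ w + jap w ^ 3) κ := ⟨by measurability, hA.meas_ker, hA.nonneg, hA.int,
    fun w => by
      have h0 := hA.nonneg w
      have hw := pow_pos (jap_pos w) 3
      rw [abs_of_nonneg (by positivity)]; linarith⟩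
  refine (hK.integrable_smul h u).norm.congr (Filter.Eventually.of_forall fun w => ?_)
  have h0 := hA.nonneg w
  have hw := pow_pos (jap_pos w) 3
  simp only [norm_smul, Real.norm_eq_abs]
  rw [abs_of_nonneg (show 0 ≤ κ w + jap w ^ 3 by positivity)]

/-- Convolution of a kernel with a function. -/
noncomputable def kconv (A h : V3 → ℝ) (u : V3) : ℝ := ∫ w, A w * h (u - w)

lemma IsKer.hasFDerivAt_kconv {A κ : V3 → ℝ} (hA : IsKer A κ) (h : 𝓢(V3, ℝ)) (u : V3) :
    HasFDerivAt (kconv A h) (∫ w, A w • fderiv ℝ h (u - w)) u := by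
  obtain ⟨C, hC0, hC⟩ := exists_jap_bound_sub (SchwartzMap.fderivCLM ℝ V3 ℝ h)
  simp only [SchwartzMap.fderivCLM_apply] at hC
  obtain ⟨M, hM⟩ := (isCompact_closedBall u 1).exists_bound_of_continuousOn
    (continuous_jap.pow 8).continuousOn
  have hm := hA.meas
  refine hasFDerivAt_integral_of_dominated_of_fderiv_le (s := Metric.closedBall u 1)
    (F := fun u w => A w * h (u - w)) (F' := fun u w => A w • fderiv ℝ h (u - w))
    (bound := fun w => (2 * (C * M)) * ((κ w + jap w ^ 3) * (jap w ^ 8)⁻¹))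
    (Metric.closedBall_mem_nhds u one_pos) ?_ ?_ ?_ ?_ ?_ ?_
  · exact Filter.Eventually.of_forall fun x => (hA.integrable_smul h x).aestronglyMeasurable
  · exact hA.integrable_smul h u
  · exact (hA.integrable_smul (SchwartzMap.fderivCLM ℝ V3 ℝ h) u).aestronglyMeasurable
  · refine Filter.Eventually.of_forall fun w x hx => ?_
    have h0 := hA.nonneg w
    have hw := jap_pos w
    have hMx : jap x ^ 8 ≤ M := (le_abs_self _).trans (hM x hx)
    rw [norm_smul, Real.norm_eq_abs]
    calc |A w| * ‖fderiv ℝ h (x - w)‖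
        ≤ (2 * (κ w + jap w ^ 3)) * (C * jap x ^ 8 * (jap w ^ 8)⁻¹) := by
          gcongr
          · exact hA.bound w
          · exact hC x w
      _ ≤ (2 * (κ w + jap w ^ 3)) * (C * M * (jap w ^ 8)⁻¹) := by gcongr
      _ = _ := by ring
  · exact hA.integrable_dom.const_mul _
  · refine Filter.Eventually.of_forall fun w x _ => ?_
    have := (h.hasFDerivAt (x - w)).comp x ((hasFDerivAt_id x).sub_const w)
    simpa using this.const_mul (A w)

lemma IsKer.fderiv_kconv {A κ : V3 → ℝ} (hA : IsKer A κ) (h : 𝓢(V3, ℝ)) (u e : V3) :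
    fderiv ℝ (kconv A h) u e = kconv A (∂_{e} h : 𝓢(V3, ℝ)) u := by
  rw [(hA.hasFDerivAt_kconv h u).fderiv]
  exact ContinuousLinearMap.integral_apply
    (hA.integrable_smul (SchwartzMap.fderivCLM ℝ V3 ℝ h) u) e

lemma IsKer.abs_kconv_le {A κ : V3 → ℝ} (hA : IsKer A κ) (h : 𝓢(V3, ℝ)) (u : V3) :
    |kconv A h u| ≤ 2 * ∫ w, (κ w + jap w ^ 3) * |h (u - w)| := by
  rw [← integral_const_mul, ← Real.norm_eq_abs, kconv]
  refine norm_integral_le_of_norm_le ((hA.integrable_dom_mul h u).const_mul 2)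
    (Filter.Eventually.of_forall fun w => ?_)
  rw [norm_mul, Real.norm_eq_abs, Real.norm_eq_abs, ← mul_assoc]
  gcongr
  exact hA.bound w

open Filter Topology

lemma Function.HasTemperateGrowth.fderiv_of {E F : Type*} [NormedAddCommGroup E] [NormedSpace ℝ E]
    [NormedAddCommGroup F] [NormedSpace ℝ F] {f : E → F} (hf : f.HasTemperateGrowth) :
    (fderiv ℝ f).HasTemperateGrowth := by
  refine ⟨hf.1.fderiv_right (by simp), fun n => ?_⟩
  obtain ⟨k, C, h⟩ := hf.2 (n + 1)
  exact ⟨k, C, fun x => by rw [norm_iteratedFDeriv_fderiv]; exact h x⟩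

lemma hasTemperateGrowth_pd {f : V3 → ℝ} (hf : f.HasTemperateGrowth) (j : Fin 3) :
    (pd j f).HasTemperateGrowth :=
  ((ContinuousLinearMap.apply ℝ ℝ (e3 j)).hasTemperateGrowth).comp hf.fderiv_of

lemma hasTemperateGrowth_coord (i : Fin 3) :
    (fun u : V3 => u i).HasTemperateGrowth :=
  (EuclideanSpace.proj (𝕜 := ℝ) i : V3 →L[ℝ] ℝ).hasTemperateGrowth

lemma Function.HasTemperateGrowth.differentiable {f : V3 → ℝ} (hf : f.HasTemperateGrowth) :
    Differentiable ℝ f :=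
  hf.1.differentiable (by simp)

lemma pd_mul {f g : V3 → ℝ} {u : V3} (hf : DifferentiableAt ℝ f u) (hg : DifferentiableAt ℝ g u)
    (j : Fin 3) : pd j (fun v => f v * g v) u = f u * pd j g u + g u * pd j f u := by
  simp [pd, fderiv_fun_mul hf hg]

lemma pd_sub {f g : V3 → ℝ} {u : V3} (hf : DifferentiableAt ℝ f u) (hg : DifferentiableAt ℝ g u)
    (j : Fin 3) : pd j (fun v => f v - g v) u = pd j f u - pd j g u := by
  simp [pd, fderiv_fun_sub hf hg]

lemma pd_coord (i j : Fin 3) (u : V3) :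
    pd j (fun v => v i) u = if i = j then 1 else 0 := by
  have h : HasFDerivAt (fun v : V3 => v i) (EuclideanSpace.proj (𝕜 := ℝ) i : V3 →L[ℝ] ℝ) u :=
    (EuclideanSpace.proj (𝕜 := ℝ) i : V3 →L[ℝ] ℝ).hasFDerivAt
  rw [pd, h.fderiv]
  simp [e3]

lemma hasFDerivAt_norm_sq (u : V3) :
    HasFDerivAt (fun v : V3 => ‖v‖ ^ 2) (2 • innerSL ℝ u) u := by
  simpa using (hasFDerivAt_id u).norm_sq

lemma inner_e3 (u : V3) (j : Fin 3) : inner ℝ u (e3 j) = u j := by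
  simp [e3, EuclideanSpace.inner_single_right]

lemma pd_norm_sq (j : Fin 3) (u : V3) : pd j (fun v => ‖v‖ ^ 2) u = 2 * u j := by
  rw [pd, (hasFDerivAt_norm_sq u).fderiv]
  simp [inner_e3]

/-- The regularized power `(δ² + |u|²)^r`. -/
noncomputable def regPow (r δ : ℝ) (u : V3) : ℝ := (δ ^ 2 + ‖u‖ ^ 2) ^ r

lemma regPow_nonneg (r δ : ℝ) (u : V3) : 0 ≤ regPow r δ u :=
  Real.rpow_nonneg (by positivity) _

lemma regPow_smul {δ : ℝ} (hδ : 0 < δ) (r : ℝ) (u : V3) :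
    regPow r δ (δ • u) = δ ^ (2 * r) * (1 + ‖u‖ ^ 2) ^ r := by
  rw [regPow, norm_smul, Real.norm_of_nonneg hδ.le, Real.rpow_mul hδ.le,
    ← Real.mul_rpow (by positivity) (by positivity)]
  congr 1
  norm_num
  ring

lemma hasTemperateGrowth_regPow {δ : ℝ} (hδ : 0 < δ) (r : ℝ) :
    (regPow r δ).HasTemperateGrowth := by
  have h : regPow r δ = fun u => δ ^ (2 * r) * (1 + ‖δ⁻¹ • u‖ ^ 2) ^ r := by
    funext u
    rw [← regPow_smul hδ, smul_inv_smul₀ hδ.ne']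
  rw [h]
  refine (Function.HasTemperateGrowth.const _).mul ?_
  exact (Function.hasTemperateGrowth_one_add_norm_sq_rpow V3 r).comp
    (δ⁻¹ • ContinuousLinearMap.id ℝ V3).hasTemperateGrowth

lemma pd_regPow {δ : ℝ} (hδ : 0 < δ) (r : ℝ) (j : Fin 3) (u : V3) :
    pd j (regPow r δ) u = 2 * r * u j * regPow (r - 1) δ u := by
  have h := ((hasFDerivAt_norm_sq u).const_add (δ ^ 2)).rpow_const (p := r)
    (Or.inl (by positivity))
  rw [pd, show regPow r δ = fun v => (δ ^ 2 + ‖v‖ ^ 2) ^ r from rfl, h.fderiv]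
  simp [inner_e3, regPow]
  ring

lemma integrable_mul_schwartz {A : V3 → ℝ} (hA : A.HasTemperateGrowth) (φ : 𝓢(V3, ℝ)) :
    Integrable fun u => A u * φ u :=
  ((SchwartzMap.smulLeftCLM ℝ A φ).integrable).congr (Eventually.of_forall fun u => by
    simp [SchwartzMap.smulLeftCLM_apply_apply hA])

lemma integral_mul_lineDeriv {A : V3 → ℝ} (hA : A.HasTemperateGrowth) (φ : 𝓢(V3, ℝ))
    (j : Fin 3) :
    ∫ u, A u * (∂_{e3 j} φ : 𝓢(V3, ℝ)) u = -∫ u, pd j A u * φ u :=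
  integral_mul_fderiv_eq_neg_fderiv_mul_of_integrable
    (integrable_mul_schwartz (hasTemperateGrowth_pd hA j) φ)
    (integrable_mul_schwartz hA (∂_{e3 j} φ)) (integrable_mul_schwartz hA φ)
    (fun x _ => hA.differentiable x) (fun _ _ => φ.differentiableAt)

/-- Smooth regularization of the Landau matrix. -/
noncomputable def regA (γ δ : ℝ) (i j : Fin 3) (u : V3) : ℝ :=
  regPow (γ / 2) δ u * (‖u‖ ^ 2 * (if i = j then 1 else 0) - u i * u j)

lemma hasTemperateGrowth_quad (i j : Fin 3) :
    (fun u : V3 => ‖u‖ ^ 2 * (if i = j then (1 : ℝ) else 0) - u i * u j).HasTemperateGrowth :=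
  ((Function.hasTemperateGrowth_norm_sq V3).mul (Function.HasTemperateGrowth.const _)).sub
    ((hasTemperateGrowth_coord i).mul (hasTemperateGrowth_coord j))

lemma hasTemperateGrowth_regA {δ : ℝ} (hδ : 0 < δ) (γ : ℝ) (i j : Fin 3) :
    (regA γ δ i j).HasTemperateGrowth :=
  (hasTemperateGrowth_regPow hδ _).mul (hasTemperateGrowth_quad i j)

lemma norm_sq_eq_coords (u : V3) : ‖u‖ ^ 2 = u 0 ^ 2 + u 1 ^ 2 + u 2 ^ 2 := by
  rw [EuclideanSpace.norm_sq_eq, Fin.sum_univ_three]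
  simp

lemma pd_regA {δ : ℝ} (hδ : 0 < δ) (γ : ℝ) (i j : Fin 3) (u : V3) :
    pd j (regA γ δ i j) u =
      regPow (γ / 2) δ u * (2 * u j * (if i = j then 1 else 0)
        - (u i + u j * (if i = j then 1 else 0)))
      + (‖u‖ ^ 2 * (if i = j then 1 else 0) - u i * u j)
        * (γ * u j * regPow (γ / 2 - 1) δ u) := by
  have hi := (hasTemperateGrowth_coord i).differentiable u
  have hj := (hasTemperateGrowth_coord j).differentiable u
  have hn := (Function.hasTemperateGrowth_norm_sq V3).differentiable u
  have hc : DifferentiableAt ℝ (fun _ : V3 => (if i = j then (1 : ℝ) else 0)) u := by fun_prop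
  have h0 : pd j (fun _ : V3 => (if i = j then (1 : ℝ) else 0)) u = 0 := by simp [pd]
  have hR := (hasTemperateGrowth_regPow hδ (γ / 2)).differentiable u
  have hQ := (hasTemperateGrowth_quad i j).differentiable u
  rw [show regA γ δ i j = fun u => regPow (γ / 2) δ u *
      (‖u‖ ^ 2 * (if i = j then 1 else 0) - u i * u j) from rfl,
    pd_mul hR hQ, pd_regPow hδ, pd_sub (hn.fun_mul hc) (hi.fun_mul hj), pd_mul hn hc, pd_mul hi hj,
    pd_coord, pd_coord, pd_norm_sq, h0, if_pos rfl]
  ring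

lemma sum_pd_regA {δ : ℝ} (hδ : 0 < δ) (γ : ℝ) (i : Fin 3) (u : V3) :
    ∑ j, pd j (regA γ δ i j) u = -2 * (regPow (γ / 2) δ u * u i) := by
  simp only [pd_regA hδ, norm_sq_eq_coords, Fin.sum_univ_three]
  fin_cases i <;> simp <;> ring

/-- The divergence of the divergence of the regularized Landau matrix. -/
noncomputable def regC (γ δ : ℝ) (u : V3) : ℝ :=
  -2 * (γ * ‖u‖ ^ 2 * regPow (γ / 2 - 1) δ u + 3 * regPow (γ / 2) δ u)

lemma sum_pd_regPow_mul {δ : ℝ} (hδ : 0 < δ) (γ : ℝ) (u : V3) :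
    ∑ i, pd i (fun v => regPow (γ / 2) δ v * v i) u =
      γ * ‖u‖ ^ 2 * regPow (γ / 2 - 1) δ u + 3 * regPow (γ / 2) δ u := by
  have h (i : Fin 3) : pd i (fun v => regPow (γ / 2) δ v * v i) u =
      regPow (γ / 2) δ u + u i * (γ * u i * regPow (γ / 2 - 1) δ u) := by
    rw [pd_mul ((hasTemperateGrowth_regPow hδ _).differentiable u)
      ((hasTemperateGrowth_coord i).differentiable u), pd_coord, pd_regPow hδ, if_pos rfl]
    ring
  simp only [h, norm_sq_eq_coords, Fin.sum_univ_three]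
  ring

lemma sum_integral_regA {δ : ℝ} (hδ : 0 < δ) (γ : ℝ) (φ : 𝓢(V3, ℝ)) :
    ∑ i, ∑ j, ∫ u, regA γ δ i j u * (∂_{e3 j} (∂_{e3 i} φ : 𝓢(V3, ℝ)) : 𝓢(V3, ℝ)) u =
      ∫ u, regC γ δ u * φ u := by
  have hb (i : Fin 3) : (fun v : V3 => regPow (γ / 2) δ v * v i).HasTemperateGrowth :=
    (hasTemperateGrowth_regPow hδ (γ / 2)).mul (hasTemperateGrowth_coord i)
  have h1 (i : Fin 3) :
      ∑ j, ∫ u, regA γ δ i j u * (∂_{e3 j} (∂_{e3 i} φ : 𝓢(V3, ℝ)) : 𝓢(V3, ℝ)) u =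
        -2 * ∫ u, pd i (fun v => regPow (γ / 2) δ v * v i) u * φ u := by
    calc _ = ∑ j, -∫ u, pd j (regA γ δ i j) u * (∂_{e3 i} φ : 𝓢(V3, ℝ)) u :=
          Finset.sum_congr rfl fun j _ =>
            integral_mul_lineDeriv (hasTemperateGrowth_regA hδ γ i j) _ j
      _ = -∫ u, ∑ j, pd j (regA γ δ i j) u * (∂_{e3 i} φ : 𝓢(V3, ℝ)) u := by
          rw [Finset.sum_neg_distrib, integral_finsetSum]
          exact fun j _ => integrable_mul_schwartz
            (hasTemperateGrowth_pd (hasTemperateGrowth_regA hδ γ i j) j) _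
      _ = 2 * ∫ u, regPow (γ / 2) δ u * u i * (∂_{e3 i} φ : 𝓢(V3, ℝ)) u := by
          rw [← integral_const_mul, ← integral_neg]
          refine integral_congr_ae (Eventually.of_forall fun u => ?_)
          simp only [← Finset.sum_mul, sum_pd_regA hδ]
          ring
      _ = _ := by
          rw [integral_mul_lineDeriv (hb i) φ i]
          ring
  simp only [h1]
  rw [← Finset.mul_sum, ← integral_finsetSum, ← integral_const_mul]
  · refine integral_congr_ae (Eventually.of_forall fun u => ?_)
    simp only [← Finset.sum_mul, sum_pd_regPow_mul hδ, regC]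
    ring
  · exact fun i _ => integrable_mul_schwartz (hasTemperateGrowth_pd (hb i) i) _

lemma sq_coord_le (u : V3) (i : Fin 3) : u i ^ 2 ≤ ‖u‖ ^ 2 := by
  rw [norm_sq_eq_coords]
  fin_cases i <;> simp <;> nlinarith [sq_nonneg (u 0), sq_nonneg (u 1), sq_nonneg (u 2)]

lemma abs_coord_mul_le (u : V3) (i j : Fin 3) : |u i * u j| ≤ ‖u‖ ^ 2 := by
  rw [abs_le]
  constructor <;>
    nlinarith [sq_coord_le u i, sq_coord_le u j, sq_nonneg (u i + u j), sq_nonneg (u i - u j)]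

lemma abs_quad_le (u : V3) (i j : Fin 3) :
    |‖u‖ ^ 2 * (if i = j then (1 : ℝ) else 0) - u i * u j| ≤ 2 * ‖u‖ ^ 2 := by
  have h := abs_coord_mul_le u i j
  rw [abs_le] at h ⊢
  have := sq_nonneg ‖u‖
  split_ifs <;> constructor <;> linarith

lemma norm_rpow_add_two {u : V3} (hu : u ≠ 0) (γ : ℝ) : ‖u‖ ^ (γ + 2) = ‖u‖ ^ γ * ‖u‖ ^ 2 := by
  rw [Real.rpow_add (norm_pos_iff.2 hu)]
  norm_num

lemma Aent_eq {u : V3} (hu : u ≠ 0) (γ : ℝ) (i j : Fin 3) :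
    Aent γ i j u = ‖u‖ ^ γ * (‖u‖ ^ 2 * (if i = j then (1 : ℝ) else 0) - u i * u j) := by
  have h := (norm_pos_iff.2 hu).ne'
  rw [Aent, norm_rpow_add_two hu]
  field_simp

lemma abs_Aent_le (γ : ℝ) (i j : Fin 3) (u : V3) : |Aent γ i j u| ≤ 2 * ‖u‖ ^ (γ + 2) := by
  rw [Aent, abs_mul, abs_of_nonneg (Real.rpow_nonneg (norm_nonneg u) _), mul_comm]
  gcongr
  have h : |u i * u j / ‖u‖ ^ 2| ≤ 1 := by
    rw [abs_div, abs_of_nonneg (sq_nonneg ‖u‖)]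
    exact div_le_one_of_le₀ (abs_coord_mul_le u i j) (sq_nonneg _)
  rw [abs_le] at h ⊢
  split_ifs <;> constructor <;> linarith

lemma Aent_symm (γ : ℝ) (i j : Fin 3) : Aent γ i j = Aent γ j i := by
  funext u
  simp only [Aent, mul_comm (u i), eq_comm (a := i)]

lemma measurable_Aent (γ : ℝ) (i j : Fin 3) : Measurable (Aent γ i j) := by
  unfold Aent
  have hc (i : Fin 3) : Measurable fun u : V3 => u i :=
    (EuclideanSpace.proj (𝕜 := ℝ) i : V3 →L[ℝ] ℝ).continuous.measurable
  exact (measurable_norm.pow_const _).mul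
    (measurable_const.sub (((hc i).mul (hc j)).div (measurable_norm.pow_const 2)))

lemma regPow_le {γ : ℝ} (hγu : γ ≤ 1) {δ : ℝ} (hδ : 0 < δ) (hδ1 : δ ≤ 1) {u : V3} (hu : u ≠ 0) :
    regPow (γ / 2) δ u ≤ ‖u‖ ^ γ + jap u := by
  have hu' := norm_pos_iff.2 hu
  have h1 : 0 ≤ ‖u‖ ^ γ := Real.rpow_nonneg hu'.le _
  have hj := jap_pos u
  have hsq (x : ℝ) (hx : 0 ≤ x) : (x ^ 2) ^ (γ / 2) = x ^ γ := by
    rw [← Real.rpow_natCast, ← Real.rpow_mul hx]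
    congr 1
    push_cast
    ring
  rcases le_total γ 0 with h | h
  · have : regPow (γ / 2) δ u ≤ (‖u‖ ^ 2) ^ (γ / 2) :=
      Real.rpow_le_rpow_of_nonpos (by positivity) (by nlinarith [sq_nonneg δ]) (by linarith)
    rw [hsq _ hu'.le] at this
    linarith
  · have : regPow (γ / 2) δ u ≤ (jap u ^ 2) ^ (γ / 2) :=
      Real.rpow_le_rpow (by positivity) (by rw [jap_sq]; nlinarith) (by linarith)
    rw [hsq _ hj.le] at this
    have h2 : jap u ^ γ ≤ jap u ^ (1 : ℝ) := Real.rpow_le_rpow_of_exponent_le (one_le_jap u) hγu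
    rw [Real.rpow_one] at h2
    linarith

lemma abs_regA_le {γ : ℝ} (hγu : γ ≤ 1) {δ : ℝ} (hδ : 0 < δ) (hδ1 : δ ≤ 1) {u : V3} (hu : u ≠ 0)
    (i j : Fin 3) : |regA γ δ i j u| ≤ 4 * (nearKer (γ + 2) u + jap u ^ 3) := by
  have h1 := regPow_le hγu hδ hδ1 hu
  have h2 := norm_rpow_le_nearKer_add (s := γ + 2) (by linarith) u
  rw [norm_rpow_add_two hu] at h2
  have h3 : ‖u‖ ^ 2 ≤ jap u ^ 2 := pow_le_pow_left₀ (norm_nonneg u) (norm_le_jap u) 2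
  have hj := jap_pos u
  have hn := nearKer_nonneg (γ + 2) u
  rw [regA, abs_mul, abs_of_nonneg (regPow_nonneg _ _ _)]
  calc _ ≤ (‖u‖ ^ γ + jap u) * (2 * ‖u‖ ^ 2) :=
        mul_le_mul h1 (abs_quad_le u i j) (abs_nonneg _) ((regPow_nonneg _ _ _).trans h1)
    _ ≤ _ := by nlinarith [mul_le_mul_of_nonneg_left h3 hj.le]

lemma abs_regC_le {γ : ℝ} (hγl : -3 ≤ γ) (hγu : γ ≤ 1) {δ : ℝ} (hδ : 0 < δ) (hδ1 : δ ≤ 1) {u : V3}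
    (hu : u ≠ 0) : |regC γ δ u| ≤ 24 * (nearKer γ u + jap u ^ 3) := by
  have h1 := regPow_le hγu hδ hδ1 hu
  have h2 := norm_rpow_le_nearKer_add (s := γ) (by linarith) u
  have hj := one_le_jap u
  have hj3 : jap u ≤ jap u ^ 3 := le_self_pow₀ hj (by norm_num)
  have hn := nearKer_nonneg γ u
  have hr := regPow_nonneg (γ / 2) δ u
  have hr' := regPow_nonneg (γ / 2 - 1) δ u
  have h3 : ‖u‖ ^ 2 * regPow (γ / 2 - 1) δ u ≤ regPow (γ / 2) δ u := by
    have hp : 0 < δ ^ 2 + ‖u‖ ^ 2 := by positivity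
    have : regPow (γ / 2) δ u = (δ ^ 2 + ‖u‖ ^ 2) * regPow (γ / 2 - 1) δ u := by
      rw [regPow, regPow, Real.rpow_sub hp, Real.rpow_one]
      field_simp
    rw [this]
    nlinarith [sq_nonneg δ]
  have h4 : 0 ≤ ‖u‖ ^ 2 * regPow (γ / 2 - 1) δ u := by positivity
  have h5 : |regC γ δ u| ≤ 12 * regPow (γ / 2) δ u := by
    rw [regC, mul_assoc γ, abs_le]
    constructor <;> nlinarith
  linarith

lemma ae_ne_zero : ∀ᵐ u : V3, u ≠ 0 := by
  simp [ae_iff]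

lemma tendsto_regA {u : V3} (hu : u ≠ 0) (γ : ℝ) (i j : Fin 3) :
    Tendsto (fun δ => regA γ δ i j u) (𝓝[>] 0) (𝓝 (Aent γ i j u)) := by
  have hu' := norm_pos_iff.2 hu
  rw [Aent_eq hu]
  have h : ‖u‖ ^ γ = regPow (γ / 2) 0 u := by
    rw [regPow, zero_pow two_ne_zero, zero_add, ← Real.rpow_natCast, ← Real.rpow_mul hu'.le]
    congr 1
    push_cast
    ring
  rw [h]
  refine Tendsto.mul_const _ (Tendsto.mono_left ?_ nhdsWithin_le_nhds)
  have : ContinuousAt (fun δ : ℝ => (δ ^ 2 + ‖u‖ ^ 2) ^ (γ / 2)) 0 :=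
    ContinuousAt.rpow_const (by fun_prop) (Or.inl (by positivity))
  exact this

lemma eventually_small : ∀ᶠ δ : ℝ in 𝓝[>] 0, 0 < δ ∧ δ ≤ 1 := by
  filter_upwards [Ioc_mem_nhdsGT (zero_lt_one (α := ℝ))] with δ hδ using hδ

lemma isKer_of_le {A : V3 → ℝ} {s : ℝ} (hs : -3 < s) (hA : Measurable A)
    (h : ∀ u, |A u| ≤ 2 * (nearKer s u + jap u ^ 3)) : IsKer A (nearKer s) :=
  ⟨hA, measurable_nearKer s, nearKer_nonneg s, integrable_nearKer hs, h⟩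

lemma isKer_dom {s : ℝ} (hs : -3 < s) :
    IsKer (fun u => nearKer s u + jap u ^ 3) (nearKer s) := by
  have hm := measurable_nearKer s
  have hj := continuous_jap.measurable
  refine isKer_of_le hs (by measurability) fun u => ?_
  have h0 := nearKer_nonneg s u
  have h1 := pow_pos (jap_pos u) 3
  rw [abs_of_nonneg (by positivity)]
  linarith

lemma integrable_nearKer_mul {s : ℝ} (hs : -3 < s) (φ : 𝓢(V3, ℝ)) :
    Integrable fun u => (nearKer s u + jap u ^ 3) * |φ u| := by
  have h := (isKer_dom hs).integrable_dom_mul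
    (SchwartzMap.compCLMOfContinuousLinearEquiv ℝ (ContinuousLinearEquiv.neg ℝ) φ) 0
  simpa using h

lemma tendsto_integral_regA {γ : ℝ} (hγl : -3 ≤ γ) (hγu : γ ≤ 1) (i j : Fin 3) (φ : 𝓢(V3, ℝ)) :
    Tendsto (fun δ => ∫ u, regA γ δ i j u * φ u) (𝓝[>] 0) (𝓝 (∫ u, Aent γ i j u * φ u)) := by
  refine tendsto_integral_filter_of_dominated_convergence
    (fun u => 4 * ((nearKer (γ + 2) u + jap u ^ 3) * |φ u|)) ?_ ?_ ?_ ?_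
  · filter_upwards [eventually_small] with δ hδ
    exact (integrable_mul_schwartz (hasTemperateGrowth_regA hδ.1 γ i j) φ).aestronglyMeasurable
  · filter_upwards [eventually_small] with δ hδ
    filter_upwards [ae_ne_zero] with u hu
    rw [norm_mul, Real.norm_eq_abs, Real.norm_eq_abs, ← mul_assoc]
    gcongr
    exact abs_regA_le hγu hδ.1 hδ.2 hu i j
  · exact (integrable_nearKer_mul (by linarith) φ).const_mul 4
  · filter_upwards [ae_ne_zero] with u hu
    exact (tendsto_regA hu γ i j).mul_const _

lemma tendsto_integral_regC {γ : ℝ} (hγl : -3 ≤ γ) (hγu : γ ≤ 1) (φ : 𝓢(V3, ℝ)) :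
    Tendsto (fun δ => ∫ u, regC γ δ u * φ u) (𝓝[>] 0)
      (𝓝 (∑ i, ∑ j, ∫ u, Aent γ i j u *
        (∂_{e3 j} (∂_{e3 i} φ : 𝓢(V3, ℝ)) : 𝓢(V3, ℝ)) u)) := by
  have h := tendsto_finsetSum Finset.univ fun i _ => tendsto_finsetSum Finset.univ fun j _ =>
    tendsto_integral_regA hγl hγu i j (∂_{e3 j} (∂_{e3 i} φ : 𝓢(V3, ℝ)) : 𝓢(V3, ℝ))
  refine h.congr' ?_
  filter_upwards [eventually_small] with δ hδ
  exact sum_integral_regA hδ.1 γ φ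

lemma integral_regC_neg_three_le {δ : ℝ} (hδ : 0 < δ) (φ : 𝓢(V3, ℝ)) :
    |∫ u, regC (-3) δ u * φ u| ≤ ∫ y : V3, 6 * ((1 + ‖y‖ ^ 2) ^ (-5 / 2 : ℝ) * |φ (δ • y)|) := by
  have h := Measure.integral_comp_smul (volume : Measure V3) (fun u => regC (-3) δ u * φ u) δ
  simp only [finrank_euclideanSpace, Fintype.card_fin, smul_eq_mul] at h
  have h3 : 0 < δ ^ 3 := by positivity
  rw [abs_of_pos (by positivity), inv_mul_eq_div, eq_div_iff h3.ne'] at h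
  rw [← h, ← Real.norm_eq_abs, ← integral_mul_const]
  have hR : Integrable fun y : V3 => (1 + ‖y‖ ^ 2) ^ (-5 / 2 : ℝ) :=
    integrable_rpow_neg_one_add_norm_sq (by simp; norm_num)
  have hint : Integrable fun y : V3 => 6 * ((1 + ‖y‖ ^ 2) ^ (-5 / 2 : ℝ) * |φ (δ • y)|) := by
    obtain ⟨C, hC⟩ : ∃ C, ∀ x, ‖φ x‖ ≤ C := ⟨_, fun x => SchwartzMap.norm_le_seminorm ℝ φ x⟩
    refine (hR.mul_bdd (c := C) ?_ (Eventually.of_forall fun y => ?_)).const_mul 6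
    · exact (φ.continuous.comp (continuous_const_smul δ)).abs.aestronglyMeasurable
    · simpa using hC (δ • y)
  refine norm_integral_le_of_norm_le hint (Eventually.of_forall fun y => ?_)
  rw [norm_mul, norm_mul, Real.norm_eq_abs (φ _), Real.norm_of_nonneg h3.le]
  have hp : 0 < 1 + ‖y‖ ^ 2 := by positivity
  have key : regC (-3) δ (δ • y) * δ ^ 3 = -6 * (1 + ‖y‖ ^ 2) ^ (-5 / 2 : ℝ) := by
    have e1 : δ ^ (2 * (-3 / 2 : ℝ)) = (δ ^ 3)⁻¹ := by
      rw [show (2 * (-3 / 2 : ℝ)) = -((3 : ℕ) : ℝ) by norm_num, Real.rpow_neg hδ.le,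
        Real.rpow_natCast]
    have e2 : δ ^ (2 * (-3 / 2 - 1 : ℝ)) = (δ ^ 5)⁻¹ := by
      rw [show (2 * (-3 / 2 - 1 : ℝ)) = -((5 : ℕ) : ℝ) by norm_num, Real.rpow_neg hδ.le,
        Real.rpow_natCast]
    have he3 : (1 + ‖y‖ ^ 2) ^ (-3 / 2 : ℝ) = (1 + ‖y‖ ^ 2) * (1 + ‖y‖ ^ 2) ^ (-5 / 2 : ℝ) := by
      rw [← Real.rpow_one_add' hp.le (by norm_num)]
      norm_num
    rw [regC, regPow_smul hδ, regPow_smul hδ, e1, e2, he3, norm_smul, Real.norm_of_nonneg hδ.le,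
      show (-3 / 2 - 1 : ℝ) = -5 / 2 by norm_num]
    field_simp
    ring
  rw [mul_right_comm, ← Real.norm_of_nonneg h3.le, ← norm_mul, key, norm_mul,
    Real.norm_of_nonneg (Real.rpow_nonneg hp.le _)]
  norm_num
  linarith

lemma exists_bound_sum_integral_Aent {γ : ℝ} (hγl : -3 ≤ γ) (hγu : γ ≤ 1) :
    ∃ s C : ℝ, -3 < s ∧ 0 ≤ C ∧ ∀ φ : 𝓢(V3, ℝ),
      |∑ i, ∑ j, ∫ u, Aent γ i j u * (∂_{e3 j} (∂_{e3 i} φ : 𝓢(V3, ℝ)) : 𝓢(V3, ℝ)) u| ≤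
        C * ((∫ u, (nearKer s u + jap u ^ 3) * |φ u|) + |φ 0|) := by
  rcases hγl.lt_or_eq with h | rfl
  · refine ⟨γ, 24, h, by norm_num, fun φ => ?_⟩
    refine le_of_tendsto (tendsto_integral_regC hγl hγu φ).abs ?_
    filter_upwards [eventually_small] with δ hδ
    have : |∫ u, regC γ δ u * φ u| ≤ ∫ u, 24 * ((nearKer γ u + jap u ^ 3) * |φ u|) := by
      rw [← Real.norm_eq_abs]
      refine norm_integral_le_of_norm_le ((integrable_nearKer_mul h φ).const_mul 24) ?_
      filter_upwards [ae_ne_zero] with u hu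
      rw [norm_mul, Real.norm_eq_abs, Real.norm_eq_abs, ← mul_assoc]
      gcongr
      exact abs_regC_le hγl hγu hδ.1 hδ.2 hu
    rw [integral_const_mul] at this
    linarith [abs_nonneg (φ 0)]
  · have hR : Integrable fun y : V3 => (1 + ‖y‖ ^ 2) ^ (-5 / 2 : ℝ) :=
      integrable_rpow_neg_one_add_norm_sq (by simp; norm_num)
    set c : ℝ := ∫ y : V3, (1 + ‖y‖ ^ 2) ^ (-5 / 2 : ℝ) with hc
    have hc0 : 0 ≤ c := integral_nonneg fun y => Real.rpow_nonneg (by positivity) _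
    refine ⟨0, 6 * c, by norm_num, by positivity, fun φ => ?_⟩
    have hlim : Tendsto (fun δ : ℝ => ∫ y : V3, 6 * ((1 + ‖y‖ ^ 2) ^ (-5 / 2 : ℝ) * |φ (δ • y)|))
        (𝓝[>] 0) (𝓝 (∫ y : V3, 6 * ((1 + ‖y‖ ^ 2) ^ (-5 / 2 : ℝ) * |φ 0|))) := by
      obtain ⟨C, hC⟩ : ∃ C, ∀ x, ‖φ x‖ ≤ C := ⟨_, fun x => SchwartzMap.norm_le_seminorm ℝ φ x⟩
      have hw := hR.aestronglyMeasurable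
      refine tendsto_integral_filter_of_dominated_convergence
        (fun y : V3 => 6 * ((1 + ‖y‖ ^ 2) ^ (-5 / 2 : ℝ) * C)) ?_ ?_ ?_ ?_
      · refine Eventually.of_forall fun δ => (hw.mul ?_).const_mul 6
        exact (φ.continuous.comp (continuous_const_smul δ)).abs.aestronglyMeasurable
      · refine Eventually.of_forall fun δ => Eventually.of_forall fun y => ?_
        rw [Real.norm_of_nonneg (by positivity)]
        gcongr
        exact hC _
      · exact (hR.mul_const C).const_mul 6
      · refine Eventually.of_forall fun y => ?_
        refine ((Tendsto.abs ?_).const_mul _).const_mul _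
        refine Tendsto.mono_left ?_ nhdsWithin_le_nhds
        have hcont : Continuous fun δ : ℝ => φ (δ • y) :=
          φ.continuous.comp (continuous_id.smul continuous_const)
        simpa using hcont.tendsto 0
    have h1 := le_of_tendsto_of_tendsto (tendsto_integral_regC le_rfl hγu φ).abs hlim
      (by filter_upwards [eventually_small] with δ hδ using integral_regC_neg_three_le hδ.1 φ)
    rw [integral_const_mul, integral_mul_const, ← hc] at h1
    have h2 : 0 ≤ ∫ u, (nearKer 0 u + jap u ^ 3) * |φ u| := integral_nonneg fun u => by
      have h0 := nearKer_nonneg 0 u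
      have h3 := jap_pos u
      positivity
    nlinarith [mul_nonneg hc0 h2]

/-- Functions of the form temperate growth times Maxwellian. -/
def IsGaussType (h : V3 → ℝ) : Prop :=
  ∃ P : V3 → ℝ, P.HasTemperateGrowth ∧ h = fun v => P v * Mu v

lemma hasFDerivAt_Mu (v : V3) : HasFDerivAt Mu (-(Mu v) • innerSL ℝ v) v := by
  have h := ((((hasFDerivAt_norm_sq v).neg).mul_const (2⁻¹ : ℝ)).exp).const_mul
    ((2 * Real.pi) ^ (-(3 : ℝ) / 2))
  have h2 : (fun v : V3 => (2 * Real.pi) ^ (-(3 : ℝ) / 2) * Real.exp (-‖v‖ ^ 2 * 2⁻¹)) = Mu := by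
    funext v; rw [Mu, div_eq_mul_inv (-‖v‖ ^ 2)]
  simp only [Pi.neg_apply] at h
  rw [h2] at h
  refine h.congr_fderiv ?_
  ext w
  simp [Mu, div_eq_mul_inv]
  ring

lemma isGaussType_Mu : IsGaussType Mu :=
  ⟨fun _ => 1, Function.HasTemperateGrowth.const 1, by simp⟩

lemma IsGaussType.differentiable {h : V3 → ℝ} (hh : IsGaussType h) : Differentiable ℝ h := by
  obtain ⟨P, hP, rfl⟩ := hh
  exact hP.differentiable.fun_mul fun v => (hasFDerivAt_Mu v).differentiableAt

lemma IsGaussType.pd {h : V3 → ℝ} (hh : IsGaussType h) (i : Fin 3) : IsGaussType (pd i h) := by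
  obtain ⟨P, hP, rfl⟩ := hh
  refine ⟨fun v => _root_.pd i P v - v i * P v,
    (hasTemperateGrowth_pd hP i).sub ((hasTemperateGrowth_coord i).mul hP), ?_⟩
  funext v
  rw [pd_mul (hP.differentiable v) (hasFDerivAt_Mu v).differentiableAt,
    show _root_.pd i Mu v = -Mu v * v i by
      rw [_root_.pd, (hasFDerivAt_Mu v).fderiv]; simp [inner_e3]]
  ring

lemma IsGaussType.pd_iterate {h : V3 → ℝ} (hh : IsGaussType h) (i : Fin 3) (n : ℕ) :
    IsGaussType ((_root_.pd i)^[n] h) := by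
  induction n with
  | zero => exact hh
  | succ n ih => rw [Function.iterate_succ_apply']; exact ih.pd i

lemma isGaussType_mderiv (β : Fin 3 → ℕ) : IsGaussType (mderiv β Mu) :=
  ((isGaussType_Mu.pd_iterate 2 _).pd_iterate 1 _).pd_iterate 0 _

lemma exists_jap_pow_mul_Mu_le (n : ℕ) : ∃ C, 0 ≤ C ∧ ∀ v : V3, jap v ^ n * Mu v ≤ C := by
  set c : ℝ := (2 * Real.pi) ^ (-(3 : ℝ) / 2)
  have hc : 0 ≤ c := Real.rpow_nonneg (by positivity) _
  refine ⟨c * (2 ^ n * n.factorial * Real.exp 1), by positivity, fun v => ?_⟩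
  have h1 := Real.pow_div_factorial_le_exp (x := jap v ^ 2 / 2) (by positivity) n
  rw [div_le_iff₀ (by positivity), div_pow, div_le_iff₀ (by positivity)] at h1
  have h2 : jap v ^ n ≤ (jap v ^ 2) ^ n :=
    pow_le_pow_left₀ (jap_pos v).le (le_self_pow₀ (one_le_jap v) two_ne_zero) n
  have h3 : Real.exp (jap v ^ 2 / 2) * Real.exp (-‖v‖ ^ 2 / 2) = Real.exp 1 := by
    rw [← Real.exp_add, jap_sq]
    congr 1
    ring
  have h4 := Real.exp_pos (-‖v‖ ^ 2 / 2)
  calc jap v ^ n * Mu v = c * (jap v ^ n * Real.exp (-‖v‖ ^ 2 / 2)) := by rw [Mu]; ring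
    _ ≤ c * (Real.exp (jap v ^ 2 / 2) * n.factorial * 2 ^ n * Real.exp (-‖v‖ ^ 2 / 2)) := by
        gcongr
        exact h2.trans h1
    _ = c * (2 ^ n * n.factorial *
          (Real.exp (jap v ^ 2 / 2) * Real.exp (-‖v‖ ^ 2 / 2))) := by ring
    _ = _ := by rw [h3]

lemma Mu_nonneg (v : V3) : 0 ≤ Mu v :=
  mul_nonneg (Real.rpow_nonneg (by positivity) _) (Real.exp_pos _).le

lemma IsGaussType.exists_bound {h : V3 → ℝ} (hh : IsGaussType h) (r : ℝ) :
    ∃ D, 0 ≤ D ∧ ∀ v, |h v| * jap v ^ r ≤ D := by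
  obtain ⟨P, hP, rfl⟩ := hh
  obtain ⟨m, C, hC⟩ := hP.2 0
  obtain ⟨n, hn⟩ := exists_nat_ge r
  obtain ⟨B, hB0, hB⟩ := exists_jap_pow_mul_Mu_le (m + n)
  have hC0 : 0 ≤ C := by simpa using (norm_nonneg _).trans (hC 0)
  refine ⟨C * 2 ^ m * B, by positivity, fun v => ?_⟩
  have hj := jap_pos v
  have hM := Mu_nonneg v
  have h1 : |P v| ≤ C * (2 * jap v) ^ m := by
    refine (by simpa using hC v : |P v| ≤ C * (1 + ‖v‖) ^ m).trans ?_
    gcongr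
    linarith [one_le_jap v, norm_le_jap v]
  have h2 : jap v ^ r ≤ jap v ^ n := by
    rw [← Real.rpow_natCast]
    exact Real.rpow_le_rpow_of_exponent_le (one_le_jap v) hn
  rw [abs_mul, abs_of_nonneg hM]
  calc |P v| * Mu v * jap v ^ r ≤ (C * (2 * jap v) ^ m) * Mu v * jap v ^ n := by gcongr
    _ = C * 2 ^ m * (jap v ^ (m + n) * Mu v) := by rw [mul_pow, pow_add]; ring
    _ ≤ _ := by gcongr; exact hB v

/-- The Schwartz function `u ↦ f (v - u)`. -/
noncomputable def reflSub (v : V3) (f : 𝓢(V3, ℝ)) : 𝓢(V3, ℝ) :=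
  SchwartzMap.compCLMOfContinuousLinearEquiv ℝ (ContinuousLinearEquiv.neg ℝ)
    (SchwartzMap.compSubConstCLM ℝ (-v) f)

lemma reflSub_apply (v : V3) (f : 𝓢(V3, ℝ)) (u : V3) : reflSub v f u = f (v - u) := by
  simp [reflSub, sub_eq_add_neg, add_comm]

lemma lineDeriv_reflSub (v e : V3) (f : 𝓢(V3, ℝ)) :
    (∂_{e} (reflSub v f) : 𝓢(V3, ℝ)) = -reflSub v (∂_{e} f : 𝓢(V3, ℝ)) := by
  ext u
  rw [_root_.neg_apply, reflSub_apply, SchwartzMap.lineDerivOp_apply_eq_fderiv,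
    SchwartzMap.lineDerivOp_apply_eq_fderiv]
  have h := (f.hasFDerivAt (v - u)).comp u ((hasFDerivAt_id u).const_sub v)
  have h2 : (⇑f ∘ HSub.hSub v) = reflSub v f := by
    funext x; simp [reflSub_apply]
  rw [h2] at h
  rw [h.fderiv]
  simp

lemma lineDeriv_lineDeriv_reflSub (v e e' : V3) (f : 𝓢(V3, ℝ)) :
    (∂_{e} (∂_{e'} (reflSub v f) : 𝓢(V3, ℝ)) : 𝓢(V3, ℝ)) =
      reflSub v (∂_{e} (∂_{e'} f : 𝓢(V3, ℝ)) : 𝓢(V3, ℝ)) := by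
  rw [lineDeriv_reflSub, LineDeriv.lineDerivOp_neg, lineDeriv_reflSub, neg_neg]

lemma isKer_Aent {γ : ℝ} (hγl : -3 ≤ γ) (hγu : γ ≤ 1) (i j : Fin 3) :
    IsKer (Aent γ i j) (nearKer (γ + 2)) :=
  isKer_of_le (by linarith) (measurable_Aent γ i j) fun u =>
    (abs_Aent_le γ i j u).trans (by
      have := norm_rpow_le_nearKer_add (s := γ + 2) (by linarith) u
      linarith)

lemma landauQ_eq {γ : ℝ} (hγl : -3 ≤ γ) (hγu : γ ≤ 1) (f : 𝓢(V3, ℝ)) {F : V3 → ℝ}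
    (hF : IsGaussType F) (v : V3) :
    LandauQ γ f F v =
      ∑ i, ∑ j, pd i (pd j F) v * kconv (Aent γ i j) f v
      - F v * ∑ i, ∑ j, ∫ u, Aent γ i j u *
          (∂_{e3 j} (∂_{e3 i} (reflSub v f) : 𝓢(V3, ℝ)) : 𝓢(V3, ℝ)) u := by
  have hK := isKer_Aent hγl hγu
  have hinner (i : Fin 3) (u : V3) : (∫ w, ∑ j : Fin 3,
      Aent γ i j (u - w) * (f w * fderiv ℝ F u (e3 j) - F u * fderiv ℝ f w (e3 j))) =
      ∑ j, (pd j F u * kconv (Aent γ i j) f u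
        - F u * kconv (Aent γ i j) (∂_{e3 j} f : 𝓢(V3, ℝ)) u) := by
    rw [← integral_sub_left_eq_self _ volume u]
    simp only [sub_sub_cancel]
    have hint (h : 𝓢(V3, ℝ)) (j : Fin 3) : Integrable fun w => Aent γ i j w * h (u - w) :=
      (hK i j).integrable_smul h u
    have he (w : V3) (j : Fin 3) : Aent γ i j w *
        (f (u - w) * fderiv ℝ F u (e3 j) - F u * fderiv ℝ f (u - w) (e3 j)) =
        pd j F u * (Aent γ i j w * f (u - w))
          - F u * (Aent γ i j w * (∂_{e3 j} f : 𝓢(V3, ℝ)) (u - w)) := by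
      rw [SchwartzMap.lineDerivOp_apply_eq_fderiv, pd]
      ring
    simp only [he]
    rw [integral_finsetSum]
    · refine Finset.sum_congr rfl fun j _ => ?_
      rw [integral_sub ((hint _ j).const_mul _) ((hint _ j).const_mul _), integral_const_mul,
        integral_const_mul, kconv, kconv]
    · exact fun j _ => ((hint _ j).const_mul _).sub ((hint _ j).const_mul _)
  have hd (i j : Fin 3) (h : 𝓢(V3, ℝ)) : DifferentiableAt ℝ (kconv (Aent γ i j) h) v :=
    ((hK i j).hasFDerivAt_kconv h v).differentiableAt
  have hderiv (i : Fin 3) : fderiv ℝ (fun u => ∑ j, (pd j F u * kconv (Aent γ i j) f u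
        - F u * kconv (Aent γ i j) (∂_{e3 j} f : 𝓢(V3, ℝ)) u)) v (e3 i) =
      ∑ j, (pd i (pd j F) v * kconv (Aent γ i j) f v
        + pd j F v * kconv (Aent γ i j) (∂_{e3 i} f : 𝓢(V3, ℝ)) v
        - pd i F v * kconv (Aent γ i j) (∂_{e3 j} f : 𝓢(V3, ℝ)) v
        - F v * kconv (Aent γ i j) (∂_{e3 i} (∂_{e3 j} f : 𝓢(V3, ℝ)) : 𝓢(V3, ℝ)) v) := by
    have hpd (j : Fin 3) := (hF.pd j).differentiable v
    rw [fderiv_fun_sum fun j _ => ((hpd j).fun_mul (hd i j f)).fun_sub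
      ((hF.differentiable v).fun_mul (hd i j _)), _root_.sum_apply]
    refine Finset.sum_congr rfl fun j _ => ?_
    have h1 := pd_sub ((hpd j).fun_mul (hd i j f))
      ((hF.differentiable v).fun_mul (hd i j (∂_{e3 j} f))) i
    have hk (h : 𝓢(V3, ℝ)) :
        pd i (kconv (Aent γ i j) h) v = kconv (Aent γ i j) (∂_{e3 i} h : 𝓢(V3, ℝ)) v :=
      (hK i j).fderiv_kconv h v (e3 i)
    rw [pd_mul (hpd j) (hd i j f), pd_mul (hF.differentiable v) (hd i j _), hk, hk] at h1
    rw [pd] at h1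
    rw [h1]
    ring
  have hswap (i j : Fin 3) : ∫ u, Aent γ i j u *
      (∂_{e3 j} (∂_{e3 i} (reflSub v f) : 𝓢(V3, ℝ)) : 𝓢(V3, ℝ)) u =
      kconv (Aent γ j i) (∂_{e3 j} (∂_{e3 i} f : 𝓢(V3, ℝ)) : 𝓢(V3, ℝ)) v := by
    rw [lineDeriv_lineDeriv_reflSub, Aent_symm γ j i]
    simp only [reflSub_apply]
    rfl
  simp only [LandauQ, hinner, hderiv, hswap]
  simp only [Fin.sum_univ_three, Aent_symm γ 1 0, Aent_symm γ 2 0, Aent_symm γ 2 1]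
  ring

/-- The nonnegative singular integral controlling the collision operator. -/
noncomputable def kerInt (s : ℝ) (f : V3 → ℝ) (v : V3) : ℝ :=
  ∫ w, (nearKer s w + jap w ^ 3) * |f (v - w)|

lemma kerInt_nonneg (s : ℝ) (f : V3 → ℝ) (v : V3) : 0 ≤ kerInt s f v :=
  integral_nonneg fun w => by
    have h0 := nearKer_nonneg s w
    have h1 := jap_pos w
    positivity

lemma exists_landauQ_bound {γ : ℝ} (hγl : -3 ≤ γ) (hγu : γ ≤ 1) (r : ℝ) {F : V3 → ℝ}
    (hF : IsGaussType F) :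
    ∃ s M : ℝ, -3 < s ∧ 0 ≤ M ∧ ∀ (f : 𝓢(V3, ℝ)) (v : V3),
      |LandauQ γ f F v| * jap v ^ r ≤ M * (kerInt (γ + 2) f v + kerInt s f v + |f v|) := by
  obtain ⟨s, C, hs, hC, hb⟩ := exists_bound_sum_integral_Aent hγl hγu
  obtain ⟨D, hD, hDb⟩ := hF.exists_bound r
  choose D' hD' hDb' using fun i j : Fin 3 => ((hF.pd j).pd i).exists_bound r
  refine ⟨s, (∑ i, ∑ j, D' i j * 2) + D * C, hs, ?_, fun f v => ?_⟩
  · have := Finset.sum_nonneg fun i (_ : i ∈ Finset.univ) =>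
      Finset.sum_nonneg fun j (_ : j ∈ Finset.univ) => mul_nonneg (hD' i j) zero_le_two
    positivity
  have hj : 0 ≤ jap v ^ r := Real.rpow_nonneg (jap_pos v).le r
  have hT := kerInt_nonneg (γ + 2) f v
  have hT' := kerInt_nonneg s f v
  have hf := abs_nonneg (f v)
  have h1 : |∑ i, ∑ j, pd i (pd j F) v * kconv (Aent γ i j) f v| * jap v ^ r ≤
      (∑ i, ∑ j, D' i j * 2) * kerInt (γ + 2) f v := by
    simp only [Finset.sum_mul]
    calc _ ≤ (∑ i, ∑ j, |pd i (pd j F) v * kconv (Aent γ i j) f v|) * jap v ^ r := by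
          gcongr
          exact (Finset.abs_sum_le_sum_abs _ _).trans
            (Finset.sum_le_sum fun i _ => Finset.abs_sum_le_sum_abs _ _)
      _ ≤ _ := by
          simp only [Finset.sum_mul]
          refine Finset.sum_le_sum fun i _ => Finset.sum_le_sum fun j _ => ?_
          rw [abs_mul, mul_right_comm, mul_assoc (D' i j)]
          gcongr
          · exact hD' i j
          · exact hDb' i j v
          · exact (isKer_Aent hγl hγu i j).abs_kconv_le f v
  have h2 := hb (reflSub v f)
  simp only [reflSub_apply, sub_zero] at h2
  set S := ∑ i, ∑ j, ∫ u, Aent γ i j u *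
    (∂_{e3 j} (∂_{e3 i} (reflSub v f) : 𝓢(V3, ℝ)) : 𝓢(V3, ℝ)) u with hS
  have h3 : |F v * S| * jap v ^ r ≤ D * C * (kerInt s f v + |f v|) := by
    rw [abs_mul, mul_right_comm, mul_assoc D]
    gcongr
    exact hDb v
    exact h2
  have hP : 0 ≤ ∑ i, ∑ j, D' i j * 2 := Finset.sum_nonneg fun i _ =>
      Finset.sum_nonneg fun j _ => mul_nonneg (hD' i j) zero_le_two
  rw [landauQ_eq hγl hγu f hF v, ← hS]
  calc _ ≤ (|∑ i, ∑ j, pd i (pd j F) v * kconv (Aent γ i j) f v| + |F v * S|) * jap v ^ r := by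
        gcongr
        exact abs_sub _ _
    _ ≤ _ := by
        have := mul_nonneg hD hC
        nlinarith [mul_nonneg hP hT', mul_nonneg hP hf, mul_nonneg this hT]

open scoped ENNReal

/-- The `L²` norm of a nonnegative extended-real function. -/
noncomputable def normTwo (a : V3 → ℝ≥0∞) : ℝ≥0∞ := (∫⁻ v, a v ^ (2 : ℝ)) ^ (1 / (2 : ℝ))

lemma normTwo_mono {a b : V3 → ℝ≥0∞} (h : ∀ v, a v ≤ b v) : normTwo a ≤ normTwo b := by
  unfold normTwo
  gcongr with v
  exact h v

lemma normTwo_sub_right (a : V3 → ℝ≥0∞) (w : V3) : normTwo (fun v => a (v - w)) = normTwo a := by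
  unfold normTwo
  rw [lintegral_sub_right_eq_self (fun v => a v ^ (2 : ℝ)) w]

lemma lintegral_mul_le_normTwo {a b : V3 → ℝ≥0∞} (ha : Measurable a) (hb : Measurable b) :
    ∫⁻ v, a v * b v ≤ normTwo a * normTwo b :=
  ENNReal.lintegral_mul_le_Lp_mul_Lq volume Real.HolderConjugate.two_two ha.aemeasurable
    hb.aemeasurable

/-- The Japanese bracket as an extended nonnegative real. -/
noncomputable def ejap (v : V3) : ℝ≥0∞ := ENNReal.ofReal (jap v)

lemma measurable_ejap : Measurable ejap :=
  continuous_jap.measurable.ennreal_ofReal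

lemma one_le_ejap (v : V3) : 1 ≤ ejap v := by
  simpa [ejap] using ENNReal.ofReal_le_ofReal (one_le_jap v)

lemma ejap_ne_top (v : V3) : ejap v ≠ ⊤ := ENNReal.ofReal_ne_top

lemma ejap_le_mul_ejap_sub (u w : V3) : ejap w ≤ ejap u * ejap (u - w) := by
  rw [ejap, ejap, ejap, ← ENNReal.ofReal_mul (jap_pos u).le]
  exact ENNReal.ofReal_le_ofReal (jap_le_mul_jap_sub u w)

lemma normTwo_le_normTwo_ejap (a : V3 → ℝ≥0∞) : normTwo a ≤ normTwo fun v => ejap v ^ 5 * a v :=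
  normTwo_mono fun v => le_mul_of_one_le_left' (one_le_pow₀ (one_le_ejap v))

lemma normTwo_ejap_inv_ne_top : normTwo (fun v => (ejap v ^ 2)⁻¹) ≠ ⊤ := by
  refine ENNReal.rpow_ne_top_of_nonneg (by norm_num) ?_
  have h := (integrable_jap_inv_pow (n := 4) (by norm_num)).lintegral_lt_top.ne
  have he (v : V3) : (ejap v ^ 2)⁻¹ ^ (2 : ℝ) = ENNReal.ofReal (jap v ^ 4)⁻¹ := by
    have := jap_pos v
    rw [ejap, ← ENNReal.ofReal_pow this.le, ← ENNReal.ofReal_inv_of_pos (by positivity),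
      ENNReal.ofReal_rpow_of_nonneg (by positivity) (by norm_num), Real.rpow_ofNat, inv_pow,
      ← pow_mul]
  simpa only [he] using h

lemma lintegral_ejap_mul_le {a : V3 → ℝ≥0∞} (ha : Measurable a) :
    ∫⁻ v, ejap v ^ 3 * a v ≤
      normTwo (fun v => (ejap v ^ 2)⁻¹) * normTwo fun v => ejap v ^ 5 * a v := by
  have hm := measurable_ejap
  refine le_trans (le_of_eq (lintegral_congr fun v => ?_))
    (lintegral_mul_le_normTwo (hm.pow_const 2).inv ((hm.pow_const 5).mul ha))
  have h0 : ejap v ^ 2 ≠ 0 := pow_ne_zero _ (one_pos.trans_le (one_le_ejap v)).ne'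
  have h1 : ejap v ^ 2 ≠ ⊤ := ENNReal.pow_ne_top (ejap_ne_top v)
  rw [← mul_assoc, show ejap v ^ 5 = ejap v ^ 2 * ejap v ^ 3 by ring, ← mul_assoc,
    ENNReal.inv_mul_cancel h0 h1, one_mul]

lemma lintegral_conv_mul_le {N a b : V3 → ℝ≥0∞} (hN : Measurable N) (ha : Measurable a)
    (hb : Measurable b) :
    ∫⁻ v, (∫⁻ w, (N w + ejap w ^ 3) * a (v - w)) * b v ≤
      ((∫⁻ w, N w) + normTwo (fun v => (ejap v ^ 2)⁻¹) ^ 2) *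
        (normTwo (fun v => ejap v ^ 5 * a v) * normTwo fun v => ejap v ^ 5 * b v) := by
  have hm := measurable_ejap
  set E := normTwo (fun v => ejap v ^ 5 * a v)
  set G := normTwo (fun v => ejap v ^ 5 * b v)
  set c := normTwo (fun v => (ejap v ^ 2)⁻¹)
  have hpt (v : V3) : (∫⁻ w, (N w + ejap w ^ 3) * a (v - w)) * b v ≤
      (∫⁻ w, N w * (a (v - w) * b v)) + (∫⁻ w, ejap w ^ 3 * a w) * (ejap v ^ 3 * b v) := by
    rw [← lintegral_sub_left_eq_self (fun w => ejap w ^ 3 * a w) v,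
      ← lintegral_mul_const _ (by fun_prop), ← lintegral_mul_const _ (by fun_prop),
      ← lintegral_add_left (by fun_prop)]
    refine lintegral_mono fun w => ?_
    have h : ejap w ^ 3 ≤ ejap v ^ 3 * ejap (v - w) ^ 3 := by
      rw [← mul_pow]
      gcongr
      exact ejap_le_mul_ejap_sub v w
    calc (N w + ejap w ^ 3) * a (v - w) * b v
        ≤ (N w + ejap v ^ 3 * ejap (v - w) ^ 3) * a (v - w) * b v := by gcongr
      _ = _ := by ring
  have hnear : ∫⁻ v, ∫⁻ w, N w * (a (v - w) * b v) ≤ (∫⁻ w, N w) * (E * G) := by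
    rw [lintegral_lintegral_swap (by fun_prop), ← lintegral_mul_const _ hN]
    refine lintegral_mono fun w => ?_
    rw [lintegral_const_mul _ (by fun_prop)]
    gcongr
    refine (lintegral_mul_le_normTwo (by fun_prop) hb).trans ?_
    rw [normTwo_sub_right]
    gcongr
    · exact normTwo_le_normTwo_ejap a
    · exact normTwo_le_normTwo_ejap b
  calc _ ≤ ∫⁻ v, ((∫⁻ w, N w * (a (v - w) * b v)) +
        (∫⁻ w, ejap w ^ 3 * a w) * (ejap v ^ 3 * b v)) := lintegral_mono hpt
    _ = (∫⁻ v, ∫⁻ w, N w * (a (v - w) * b v)) +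
        (∫⁻ w, ejap w ^ 3 * a w) * ∫⁻ v, ejap v ^ 3 * b v := by
      rw [lintegral_add_right _ (by fun_prop), lintegral_const_mul _ (by fun_prop)]
    _ ≤ (∫⁻ w, N w) * (E * G) + (c * E) * (c * G) := by
      gcongr
      · exact lintegral_ejap_mul_le ha
      · exact lintegral_ejap_mul_le hb
    _ = _ := by ring

lemma ofReal_kerInt {s : ℝ} (hs : -3 < s) (f : 𝓢(V3, ℝ)) (v : V3) :
    ENNReal.ofReal (kerInt s f v) =
      ∫⁻ w, (ENNReal.ofReal (nearKer s w) + ejap w ^ 3) * ENNReal.ofReal |f (v - w)| := by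
  have h0 (w : V3) : 0 ≤ nearKer s w + jap w ^ 3 :=
    add_nonneg (nearKer_nonneg s w) (pow_nonneg (jap_pos w).le 3)
  rw [kerInt, ofReal_integral_eq_lintegral_ofReal ((isKer_dom hs).integrable_dom_mul f v)
    (ae_of_all _ fun w => mul_nonneg (h0 w) (abs_nonneg _))]
  refine lintegral_congr fun w => ?_
  rw [ENNReal.ofReal_mul (h0 w), ENNReal.ofReal_add (nearKer_nonneg s w)
    (pow_nonneg (jap_pos w).le 3), ejap, ENNReal.ofReal_pow (jap_pos w).le]

lemma ofReal_wL2_five (f : 𝓢(V3, ℝ)) :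
    ENNReal.ofReal (wL2 5 f) = normTwo fun v => ejap v ^ 5 * ENNReal.ofReal |f v| := by
  have hsq (v : V3) : jap v ^ (2 * (5 : ℝ)) * f v ^ 2 = (jap v ^ 5 * |f v|) ^ 2 := by
    rw [show (2 * (5 : ℝ)) = ((10 : ℕ) : ℝ) by norm_num, Real.rpow_natCast, mul_pow, sq_abs,
      ← pow_mul]
  have hint : Integrable fun v : V3 => jap v ^ (2 * (5 : ℝ)) * f v ^ 2 := by
    simp only [hsq]
    obtain ⟨C, hC, hb⟩ := exists_jap_bound f
    refine ((integrable_jap_inv_pow (n := 6) (by norm_num)).const_mul (C ^ 2)).mono'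
      (((continuous_jap.pow 5).mul f.continuous.abs).pow 2).aestronglyMeasurable
      (ae_of_all _ fun v => ?_)
    have hj := jap_pos v
    rw [Real.norm_of_nonneg (by positivity)]
    calc (jap v ^ 5 * |f v|) ^ 2 ≤ (jap v ^ 5 * (C * (jap v ^ 8)⁻¹)) ^ 2 := by
          gcongr
          exact hb v
      _ = _ := by field_simp
  have h0 (v : V3) : 0 ≤ jap v ^ 5 * |f v| := mul_nonneg (pow_nonneg (jap_pos v).le 5) (abs_nonneg _)
  have hI : 0 ≤ ∫ v : V3, jap v ^ (2 * (5 : ℝ)) * f v ^ 2 :=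
    integral_nonneg fun v => by rw [hsq]; positivity
  rw [wL2, normTwo, Real.sqrt_eq_rpow, ← ENNReal.ofReal_rpow_of_nonneg hI (by norm_num),
    ofReal_integral_eq_lintegral_ofReal hint (ae_of_all _ fun v => by
      simp only [hsq]; positivity)]
  congr 1
  refine lintegral_congr fun v => ?_
  rw [hsq, ejap, ← ENNReal.ofReal_pow (jap_pos v).le,
    ← ENNReal.ofReal_mul (pow_nonneg (jap_pos v).le 5),
    ENNReal.ofReal_rpow_of_nonneg (h0 v) (by norm_num), Real.rpow_ofNat]

lemma exists_enorm_integral_landauQ_le {γ : ℝ} (hγl : -3 ≤ γ) (hγu : γ ≤ 1) (r : ℝ) {F : V3 → ℝ}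
    (hF : IsGaussType F) :
    ∃ K : ℝ≥0∞, K ≠ ⊤ ∧ ∀ f g : 𝓢(V3, ℝ),
      ‖∫ v, LandauQ γ f F v * g v * jap v ^ r‖ₑ ≤
        K * (ENNReal.ofReal (wL2 5 f) * ENNReal.ofReal (wL2 5 g)) := by
  obtain ⟨s, M, hs, hM, hb⟩ := exists_landauQ_bound hγl hγu r hF
  have hγ : -3 < γ + 2 := by linarith
  set c := normTwo (fun v => (ejap v ^ 2)⁻¹)
  let I (t : ℝ) : ℝ≥0∞ := ∫⁻ w, ENNReal.ofReal (nearKer t w)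
  have hI {t : ℝ} (ht : -3 < t) : I t ≠ ⊤ := (integrable_nearKer ht).lintegral_lt_top.ne
  refine ⟨ENNReal.ofReal M * ((I (γ + 2) + c ^ 2) + (I s + c ^ 2) + 1), ?_, fun f g => ?_⟩
  · have h1 := hI hγ
    have h2 := hI hs
    have h3 : c ≠ ⊤ := normTwo_ejap_inv_ne_top
    finiteness
  rw [ofReal_wL2_five, ofReal_wL2_five]
  set a : V3 → ℝ≥0∞ := fun v => ENNReal.ofReal |f v|
  set b : V3 → ℝ≥0∞ := fun v => ENNReal.ofReal |g v|
  have ha : Measurable a := f.continuous.abs.measurable.ennreal_ofReal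
  have hb' : Measurable b := g.continuous.abs.measurable.ennreal_ofReal
  have hm := measurable_ejap
  have hN (t : ℝ) : Measurable fun w => ENNReal.ofReal (nearKer t w) :=
    (measurable_nearKer t).ennreal_ofReal
  have hmk (t : ℝ) : Measurable fun v : V3 =>
      ∫⁻ w, (ENNReal.ofReal (nearKer t w) + ejap w ^ 3) * a (v - w) := by
    exact Measurable.lintegral_prod_right
      ((((hN t).comp measurable_snd).add ((hm.comp measurable_snd).pow_const 3)).mul
        (ha.comp (measurable_fst.sub measurable_snd)))
  have hpt (v : V3) : ‖LandauQ γ f F v * g v * jap v ^ r‖ₑ ≤ ENNReal.ofReal M *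
      ((∫⁻ w, (ENNReal.ofReal (nearKer (γ + 2) w) + ejap w ^ 3) * a (v - w)) * b v +
        (∫⁻ w, (ENNReal.ofReal (nearKer s w) + ejap w ^ 3) * a (v - w)) * b v + a v * b v) := by
    have h1 := kerInt_nonneg (γ + 2) f v
    have h2 := kerInt_nonneg s f v
    rw [← ofReal_kerInt hγ, ← ofReal_kerInt hs, ← add_mul, ← add_mul,
      ← ENNReal.ofReal_add h1 h2, ← ENNReal.ofReal_add (by positivity) (abs_nonneg _),
      ← mul_assoc, ← ENNReal.ofReal_mul hM, ← ENNReal.ofReal_mul (by positivity),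
      Real.enorm_eq_ofReal_abs, abs_mul, abs_mul, mul_right_comm,
      abs_of_nonneg (Real.rpow_nonneg (jap_pos v).le r)]
    exact ENNReal.ofReal_le_ofReal (mul_le_mul_of_nonneg_right (hb f v) (abs_nonneg _))
  calc _ ≤ ∫⁻ v, ‖LandauQ γ f F v * g v * jap v ^ r‖ₑ := enorm_integral_le_lintegral_enorm _
    _ ≤ _ := lintegral_mono hpt
    _ = ENNReal.ofReal M *
      ((∫⁻ v, (∫⁻ w, (ENNReal.ofReal (nearKer (γ + 2) w) + ejap w ^ 3) * a (v - w)) * b v) +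
        (∫⁻ v, (∫⁻ w, (ENNReal.ofReal (nearKer s w) + ejap w ^ 3) * a (v - w)) * b v) +
        ∫⁻ v, a v * b v) := by
      rw [lintegral_const_mul' _ _ ENNReal.ofReal_ne_top, lintegral_add_right _ (by fun_prop),
        lintegral_add_right _ ((hmk s).fun_mul hb')]
    _ ≤ ENNReal.ofReal M * ((I (γ + 2) + c ^ 2) * (normTwo (fun v => ejap v ^ 5 * a v) *
          normTwo fun v => ejap v ^ 5 * b v) + (I s + c ^ 2) *
          (normTwo (fun v => ejap v ^ 5 * a v) * normTwo fun v => ejap v ^ 5 * b v) +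
          normTwo (fun v => ejap v ^ 5 * a v) * normTwo fun v => ejap v ^ 5 * b v) := by
      gcongr
      · exact lintegral_conv_mul_le (hN _) ha hb'
      · exact lintegral_conv_mul_le (hN _) ha hb'
      · exact (lintegral_mul_le_normTwo ha hb').trans
          (mul_le_mul' (normTwo_le_normTwo_ejap a) (normTwo_le_normTwo_ejap b))
    _ = _ := by ring

/-- Lemma 2.1 (first estimate, Landau case):
`(Q(f, ∂_β μ), g ⟨v⟩^{2k}) ≤ C_k ‖f‖_{L²(⟨v⟩⁵)} ‖g‖_{L²(⟨v⟩⁵)}` for `|β| ≤ 2`, `k ≥ 7`. -/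
theorem landauQ_maxwellian_derivative_bound (γ k : ℝ)
    (hγl : -3 ≤ γ) (hγu : γ ≤ 1) (hk : 7 ≤ k)
    (β : Fin 3 → ℕ) (hβ : β 0 + β 1 + β 2 ≤ 2) :
    ∃ C > (0 : ℝ), ∀ f g : SchwartzMap (EuclideanSpace ℝ (Fin 3)) ℝ,
      (∫ v, LandauQ γ (⇑f) (mderiv β Mu) v * g v * jap v ^ (2 * k)) ≤
        C * wL2 5 (⇑f) * wL2 5 (⇑g) := by
  obtain ⟨K, hK, h⟩ := exists_enorm_integral_landauQ_le hγl hγu (2 * k) (isGaussType_mderiv β)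
  refine ⟨K.toReal + 1, by positivity, fun f g => ?_⟩
  have h0 (u : V3 → ℝ) : 0 ≤ wL2 5 u := Real.sqrt_nonneg _
  have hp := mul_nonneg (h0 f) (h0 g)
  have h1 := h f g
  rw [← ENNReal.ofReal_toReal hK, ← ENNReal.ofReal_mul (h0 f),
    ← ENNReal.ofReal_mul ENNReal.toReal_nonneg, Real.enorm_eq_ofReal_abs,
    ENNReal.ofReal_le_ofReal_iff (mul_nonneg ENNReal.toReal_nonneg hp)] at h1
  refine (le_abs_self _).trans (h1.trans ?_)
  rw [mul_assoc]
  gcongr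
  linarith
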